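/- Let n ≥ 1, κ > 0, let μ0 be a finite nonnegative compactly supported Borel measure on ℝ^n absolutely continuous with respect to Lebesgue measure, μ1 a finite nonnegative compactly supported Borel measure, and let (v0, α0, μ1^⊥) be the HK logarithmic map components of μ1 at μ0. Then HK_κ²(μ0,μ1) = ∫ |v0|² dμ0 + (κ²/4) ∫ α0² dμ0 + κ² μ1^⊥(ℝ^n). -/

import Mathlib

open MeasureTheory ENNReal Filter Topology RealInnerProductSpace
open scoped Classical

noncomputable section

abbrev Eucl (n : ℕ) : Type := EuclideanSpace ℝ (Fin n)

/-- Truncated cosine `Cos`. -/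
def truncCos (s : ℝ) : ℝ := Real.cos (min |s| (Real.pi / 2))

/-- The Hellinger–Kantorovich cost function `c_κ`. -/
def cHK {n : ℕ} (κ : ℝ) (x y : Eucl n) : ℝ≥0∞ :=
  if dist x y < κ * Real.pi / 2 then
    ENNReal.ofReal (-2 * κ ^ 2 * Real.log (Real.cos (dist x y / κ)))
  else ⊤

/-- Kullback–Leibler divergence `KL(ρ|μ)`. -/
def KLdiv {α : Type*} [MeasurableSpace α] (ρ μ : Measure α) : ℝ≥0∞ :=
  if ρ ≪ μ then
    ∫⁻ x, ENNReal.ofReal ((ρ.rnDeriv μ x).toReal * Real.log (ρ.rnDeriv μ x).toReal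
      - (ρ.rnDeriv μ x).toReal + 1) ∂μ
  else ⊤

/-- The soft-marginal Hellinger–Kantorovich functional `E_κ(π|μ0,μ1)`. -/
def HKfun {n : ℕ} (κ : ℝ) (π : Measure (Eucl n × Eucl n)) (μ0 μ1 : Measure (Eucl n)) : ℝ≥0∞ :=
  ∫⁻ p, cHK κ p.1 p.2 ∂π + ENNReal.ofReal (κ ^ 2) * KLdiv (π.map Prod.fst) μ0
    + ENNReal.ofReal (κ ^ 2) * KLdiv (π.map Prod.snd) μ1

/-- The squared Hellinger–Kantorovich distance `HK_κ²(μ0,μ1)`. -/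
def HK2 {n : ℕ} (κ : ℝ) (μ0 μ1 : Measure (Eucl n)) : ℝ≥0∞ :=
  ⨅ (π : Measure (Eucl n × Eucl n)) (_ : IsFiniteMeasure π), HKfun κ π μ0 μ1

/-- The squared 2-Wasserstein distance `W2²(μ0,μ1)`. -/
def W2sq {n : ℕ} (μ0 μ1 : Measure (Eucl n)) : ℝ≥0∞ :=
  ⨅ (π : Measure (Eucl n × Eucl n))
    (_ : π.map Prod.fst = μ0 ∧ π.map Prod.snd = μ1),
      ∫⁻ p, ENNReal.ofReal (dist p.1 p.2 ^ 2) ∂π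

/-- Narrow convergence of a sequence of measures. -/
def NarrowTendsto {α : Type*} [MeasurableSpace α] [TopologicalSpace α]
    (ρ : ℕ → Measure α) (ρlim : Measure α) : Prop :=
  ∀ φ : BoundedContinuousFunction α ℝ,
    Tendsto (fun N => ∫ x, φ x ∂(ρ N)) atTop (𝓝 (∫ x, φ x ∂ρlim))

/-- The spherical Hellinger–Kantorovich distance `SHK_κ(μ0,μ1)`. -/
def SHK {n : ℕ} (κ : ℝ) (μ0 μ1 : Measure (Eucl n)) : ℝ :=
  κ * Real.arccos (1 - (HK2 κ μ0 μ1).toReal / (2 * κ ^ 2))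

/-- The square-root measure `√(ρσ)`. -/
def sqrtMeasure {α : Type*} [MeasurableSpace α] (ρ σ : Measure α) : Measure α :=
  (ρ + σ).withDensity (fun x => (ρ.rnDeriv (ρ + σ) x * σ.rnDeriv (ρ + σ) x) ^ (1/2 : ℝ))



/-- barycentric HK velocity. -/
def barV {n : ℕ} (κ : ℝ) (μ0 : Measure (Eucl n)) (π : Measure (Eucl n × Eucl n))
    [IsFiniteMeasure π] (x : Eucl n) : Eucl n :=
  (κ * ((π.map Prod.fst).rnDeriv μ0 x).toReal) •
    ∫ y, (Real.tan (‖y - x‖ / κ) / ‖y - x‖) • (y - x) ∂(π.condKernel x)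

/-- barycentric HK growth. -/
def barA {n : ℕ} (μ0 : Measure (Eucl n)) (π : Measure (Eucl n × Eucl n)) (x : Eucl n) : ℝ :=
  2 * (((π.map Prod.fst).rnDeriv μ0 x).toReal - 1)

/-- barycentric W2 velocity. -/
def barW {n : ℕ} (π : Measure (Eucl n × Eucl n)) [IsFiniteMeasure π] (x : Eucl n) : Eucl n :=
  ∫ y, (y - x) ∂(π.condKernel x)

end

section KullbackLeibler

open InformationTheory
open scoped NNReal

variable {α : Type*} [MeasurableSpace α]

theorem KLdiv_eq_klDiv (ρ μ : Measure α) [IsFiniteMeasure ρ] [IsFiniteMeasure μ] :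
    KLdiv ρ μ = klDiv ρ μ := by
  simp only [KLdiv, klDiv_eq_lintegral_klFun, klFun_apply, sub_add_eq_add_sub]

/-- If `ρ` is squeezed between two multiples of `σ`, so is its density. -/
theorem abs_rnDeriv_sub_one_le {ρ σ : Measure α} [IsFiniteMeasure ρ] [IsFiniteMeasure σ]
    {δ : ℝ≥0} (hl : (1 - δ) • σ ≤ ρ) (hu : ρ ≤ (1 + δ) • σ) :
    ∀ᵐ x ∂σ, |(ρ.rnDeriv σ x).toReal - 1| ≤ δ := by
  have hac : ρ ≪ σ :=
    (Measure.absolutelyContinuous_of_le hu).trans (Measure.smul_absolutelyContinuous)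
  have h1 : (fun _ => ((1 - δ : ℝ≥0) : ℝ≥0∞)) ≤ᵐ[σ] ρ.rnDeriv σ := by
    refine ae_le_of_forall_setLIntegral_le_of_sigmaFinite measurable_const fun s _ _ => ?_
    rw [Measure.setLIntegral_rnDeriv hac, setLIntegral_const]
    simpa using hl s
  have h2 : ρ.rnDeriv σ ≤ᵐ[σ] fun _ => ((1 + δ : ℝ≥0) : ℝ≥0∞) := by
    refine ae_le_of_forall_setLIntegral_le_of_sigmaFinite (Measure.measurable_rnDeriv _ _)
      fun s _ _ => ?_
    rw [Measure.setLIntegral_rnDeriv hac, setLIntegral_const]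
    simpa using hu s
  filter_upwards [h1, h2, Measure.rnDeriv_lt_top ρ σ] with x hx1 hx2 hx3
  lift ρ.rnDeriv σ x to ℝ≥0 using hx3.ne with r
  have a1 : 1 - δ ≤ r := by exact_mod_cast hx1
  have a2 : r ≤ 1 + δ := by exact_mod_cast hx2
  have a3 : (1 : ℝ) ≤ r + δ := by exact_mod_cast tsub_le_iff_right.mp a1
  have a4 : (r : ℝ) ≤ 1 + δ := by exact_mod_cast a2
  rw [ENNReal.coe_toReal, abs_le]
  constructor <;> linarith

theorem klFun_le_sub_one_sq {x : ℝ} (hx : 0 ≤ x) : klFun x ≤ (x - 1) ^ 2 := by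
  rcases hx.eq_or_lt with rfl | hx
  · simp [klFun_zero]
  · rw [klFun_apply]
    nlinarith [mul_le_mul_of_nonneg_left (Real.log_le_sub_one_of_pos hx) hx.le]

/-- The divergence is quadratically small for measures close to the reference measure. -/
theorem klDiv_le_sq_mul {ρ σ : Measure α} [IsFiniteMeasure ρ] [IsFiniteMeasure σ]
    {δ : ℝ≥0} (hl : (1 - δ) • σ ≤ ρ) (hu : ρ ≤ (1 + δ) • σ) :
    klDiv ρ σ ≤ ENNReal.ofReal ((δ : ℝ) ^ 2) * σ Set.univ := by
  have hac : ρ ≪ σ :=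
    (Measure.absolutelyContinuous_of_le hu).trans (Measure.smul_absolutelyContinuous)
  rw [klDiv_eq_lintegral_klFun_of_ac hac, ← lintegral_const]
  refine lintegral_mono_ae ?_
  filter_upwards [abs_rnDeriv_sub_one_le hl hu] with x hx
  refine ENNReal.ofReal_le_ofReal ((klFun_le_sub_one_sq ENNReal.toReal_nonneg).trans ?_)
  exact sq_le_sq' (by linarith [abs_le.mp hx]) (abs_le.mp hx).2

/-- Chain rule for the Kullback–Leibler divergence along `ρ ≪ σ ≪ μ`. -/
theorem toReal_klDiv_chain {ρ σ μ : Measure α} [IsFiniteMeasure ρ] [IsFiniteMeasure σ]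
    [IsFiniteMeasure μ] (hσμ : σ ≪ μ) (hρσ : klDiv ρ σ ≠ ⊤) (hint : Integrable (llr σ μ) ρ) :
    klDiv ρ μ ≠ ⊤ ∧ (klDiv ρ μ).toReal =
      (klDiv ρ σ).toReal + ∫ x, llr σ μ x ∂ρ + μ.real Set.univ - σ.real Set.univ := by
  obtain ⟨hac, hint'⟩ := klDiv_ne_top_iff.mp hρσ
  have hae : llr ρ μ =ᵐ[ρ] fun x => llr ρ σ x + llr σ μ x := by
    filter_upwards [(hac.trans hσμ).ae_le (Measure.rnDeriv_mul_rnDeriv (κ := μ) hac),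
      Measure.rnDeriv_pos hac, hac.ae_le (Measure.rnDeriv_lt_top ρ σ),
      hac.ae_le (Measure.rnDeriv_pos hσμ), (hac.trans hσμ).ae_le (Measure.rnDeriv_lt_top σ μ)]
      with x h1 h2 h3 h4 h5
    rw [llr, llr, llr, ← h1, Pi.mul_apply, ENNReal.toReal_mul, Real.log_mul]
    · exact (ENNReal.toReal_pos h2.ne' h3.ne).ne'
    · exact (ENNReal.toReal_pos h4.ne' h5.ne).ne'
  have hint2 : Integrable (llr ρ μ) ρ := (hint'.add hint).congr hae.symm
  refine ⟨klDiv_ne_top (hac.trans hσμ) hint2, ?_⟩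
  rw [toReal_klDiv (hac.trans hσμ) hint2, toReal_klDiv hac hint', integral_congr_ae hae,
    integral_add hint' hint]
  ring

end KullbackLeibler

section FirstOrderOptimality

open InformationTheory
open scoped NNReal

variable {n : ℕ} {κ : ℝ} {μ0 μ1 : Measure (Eucl n)} [IsFiniteMeasure μ0] [IsFiniteMeasure μ1]

theorem measurable_cHK (κ : ℝ) : Measurable fun p : Eucl n × Eucl n => cHK κ p.1 p.2 := by
  have hd : Measurable fun p : Eucl n × Eucl n => dist p.1 p.2 := continuous_dist.measurable
  refine Measurable.ite (measurableSet_lt hd measurable_const) ?_ measurable_const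
  exact ((Real.measurable_log.comp
    (Real.measurable_cos.comp (hd.div_const κ))).const_mul _).ennreal_ofReal

/-- The first variation at `π` of the Hellinger–Kantorovich functional. -/
noncomputable def hkVariation (κ : ℝ) (π : Measure (Eucl n × Eucl n)) (μ0 μ1 : Measure (Eucl n))
    (p : Eucl n × Eucl n) : ℝ :=
  (cHK κ p.1 p.2).toReal + κ ^ 2 * llr (π.map Prod.fst) μ0 p.1
    + κ ^ 2 * llr (π.map Prod.snd) μ1 p.2

theorem HKfun_ne_top_iff (hκ : 0 < κ) (π : Measure (Eucl n × Eucl n)) [IsFiniteMeasure π] :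
    HKfun κ π μ0 μ1 ≠ ⊤ ↔ ∫⁻ p, cHK κ p.1 p.2 ∂π ≠ ⊤ ∧ klDiv (π.map Prod.fst) μ0 ≠ ⊤ ∧
      klDiv (π.map Prod.snd) μ1 ≠ ⊤ := by
  have h : ENNReal.ofReal (κ ^ 2) ≠ 0 := by simp [hκ.ne']
  simp [HKfun, KLdiv_eq_klDiv, ENNReal.mul_eq_top, h, and_assoc]

/-- The terms of the first variation are integrable at a measure of finite energy. -/
theorem integrable_terms (hκ : 0 < κ) {π : Measure (Eucl n × Eucl n)} [IsFiniteMeasure π]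
    (hfin : HKfun κ π μ0 μ1 ≠ ⊤) :
    Integrable (fun p => (cHK κ p.1 p.2).toReal) π ∧
      Integrable (fun p => llr (π.map Prod.fst) μ0 p.1) π ∧
      Integrable (fun p => llr (π.map Prod.snd) μ1 p.2) π := by
  obtain ⟨hc, h0, h1⟩ := (HKfun_ne_top_iff hκ π).mp hfin
  exact ⟨integrable_toReal_of_lintegral_ne_top (measurable_cHK κ).aemeasurable hc,
    (klDiv_ne_top_iff.mp h0).2.comp_measurable measurable_fst,
    (klDiv_ne_top_iff.mp h1).2.comp_measurable measurable_snd⟩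

theorem integrable_hkVariation (hκ : 0 < κ) {π : Measure (Eucl n × Eucl n)} [IsFiniteMeasure π]
    (hfin : HKfun κ π μ0 μ1 ≠ ⊤) : Integrable (hkVariation κ π μ0 μ1) π := by
  obtain ⟨hc, h0, h1⟩ := integrable_terms hκ hfin
  exact (hc.add (h0.const_mul _)).add (h1.const_mul _)

/-- Expansion of the energy of a measure `ν` comparable to `π`. -/
theorem toReal_HKfun_expansion (hκ : 0 < κ) {π ν : Measure (Eucl n × Eucl n)} [IsFiniteMeasure π]
    [IsFiniteMeasure ν] (hfin : HKfun κ π μ0 μ1 ≠ ⊤) {δ : ℝ≥0}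
    (hl : (1 - δ) • π ≤ ν) (hu : ν ≤ (1 + δ) • π) :
    HKfun κ ν μ0 μ1 ≠ ⊤ ∧ (HKfun κ ν μ0 μ1).toReal =
      ∫ p, hkVariation κ π μ0 μ1 p ∂ν
        + κ ^ 2 * (μ0.real Set.univ + μ1.real Set.univ - 2 * π.real Set.univ)
        + κ ^ 2 * ((klDiv (ν.map Prod.fst) (π.map Prod.fst)).toReal
          + (klDiv (ν.map Prod.snd) (π.map Prod.snd)).toReal) := by
  have hu' : ν ≤ ((1 + δ : ℝ≥0) : ℝ≥0∞) • π := hu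
  obtain ⟨ic, i0, i1⟩ := integrable_terms hκ hfin
  replace ic := ic.of_measure_le_smul ENNReal.coe_ne_top hu'
  replace i0 := i0.of_measure_le_smul ENNReal.coe_ne_top hu'
  replace i1 := i1.of_measure_le_smul ENNReal.coe_ne_top hu'
  obtain ⟨hc, h0, h1⟩ := (HKfun_ne_top_iff hκ π).mp hfin
  have hcν : ∫⁻ p, cHK κ p.1 p.2 ∂ν ≠ ⊤ := by
    refine ne_top_of_le_ne_top ?_ (lintegral_mono' hu' le_rfl)
    rw [lintegral_smul_measure]
    exact ENNReal.mul_ne_top ENNReal.coe_ne_top hc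
  have key : ∀ (f : Eucl n × Eucl n → Eucl n) (_ : Measurable f) (μ : Measure (Eucl n))
      (_ : IsFiniteMeasure μ) (_ : klDiv (π.map f) μ ≠ ⊤)
      (_ : Integrable (fun p => llr (π.map f) μ (f p)) ν),
      klDiv (ν.map f) μ ≠ ⊤ ∧ (klDiv (ν.map f) μ).toReal =
        (klDiv (ν.map f) (π.map f)).toReal + ∫ p, llr (π.map f) μ (f p) ∂ν
          + μ.real Set.univ - π.real Set.univ := by
    intro f hf μ _ hμ hi
    have hm : (π.map f).real Set.univ = π.real Set.univ := by
      simp [measureReal_def, Measure.map_apply hf MeasurableSet.univ]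
    have hn : klDiv (ν.map f) (π.map f) ≠ ⊤ := by
      refine ne_top_of_le_ne_top ?_ (klDiv_le_sq_mul (δ := δ) ?_ ?_)
      · finiteness
      · rw [← Measure.map_smul]
        exact Measure.map_mono hl hf
      · rw [← Measure.map_smul]
        exact Measure.map_mono hu hf
    have hmeas := (stronglyMeasurable_llr (π.map f) μ).aestronglyMeasurable (μ := ν.map f)
    have := toReal_klDiv_chain (klDiv_ne_top_iff.mp hμ).1 hn
      ((integrable_map_measure hmeas hf.aemeasurable).mpr hi)
    rwa [integral_map hf.aemeasurable hmeas, hm] at this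
  obtain ⟨a0, b0⟩ := key Prod.fst measurable_fst μ0 inferInstance h0 i0
  obtain ⟨a1, b1⟩ := key Prod.snd measurable_snd μ1 inferInstance h1 i1
  refine ⟨(HKfun_ne_top_iff hκ ν).mpr ⟨hcν, a0, a1⟩, ?_⟩
  have hctop : ∀ᵐ p ∂ν, cHK κ p.1 p.2 < ⊤ := ae_lt_top (measurable_cHK κ) hcν
  rw [HKfun, KLdiv_eq_klDiv, KLdiv_eq_klDiv, ENNReal.toReal_add (by finiteness) (by finiteness),
    ENNReal.toReal_add (by finiteness) (by finiteness), ENNReal.toReal_mul, ENNReal.toReal_mul,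
    ENNReal.toReal_ofReal (by positivity), b0, b1,
    ← integral_toReal (measurable_cHK κ).aemeasurable hctop]
  have : ∫ p, hkVariation κ π μ0 μ1 p ∂ν = ∫ p, (cHK κ p.1 p.2).toReal ∂ν
      + κ ^ 2 * ∫ p, llr (π.map Prod.fst) μ0 p.1 ∂ν
      + κ ^ 2 * ∫ p, llr (π.map Prod.snd) μ1 p.2 ∂ν := by
    unfold hkVariation
    have i01 : Integrable (fun p => (cHK κ p.1 p.2).toReal
        + κ ^ 2 * llr (π.map Prod.fst) μ0 p.1) ν := ic.add (i0.const_mul _)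
    rw [integral_add i01 (i1.const_mul _),
      integral_add ic (i0.const_mul _), integral_const_mul, integral_const_mul]
  rw [this]
  ring

/-- The energy of `π` is given by its first variation. -/
theorem toReal_HKfun_self (hκ : 0 < κ) {π : Measure (Eucl n × Eucl n)} [IsFiniteMeasure π]
    (hfin : HKfun κ π μ0 μ1 ≠ ⊤) :
    (HKfun κ π μ0 μ1).toReal = ∫ p, hkVariation κ π μ0 μ1 p ∂π
        + κ ^ 2 * (μ0.real Set.univ + μ1.real Set.univ - 2 * π.real Set.univ) := by
  have := (toReal_HKfun_expansion hκ (ν := π) hfin (δ := 0) (by simp) (by simp)).2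
  simpa [klDiv_self] using this

theorem integral_hkVariation_le (hκ : 0 < κ) {π ν : Measure (Eucl n × Eucl n)}
    [IsFiniteMeasure π] [IsFiniteMeasure ν] (hfin : HKfun κ π μ0 μ1 ≠ ⊤)
    (hle : HKfun κ π μ0 μ1 ≤ HKfun κ ν μ0 μ1) {δ : ℝ≥0}
    (hl : (1 - δ) • π ≤ ν) (hu : ν ≤ (1 + δ) • π) :
    ∫ p, hkVariation κ π μ0 μ1 p ∂π ≤
      ∫ p, hkVariation κ π μ0 μ1 p ∂ν + 2 * κ ^ 2 * π.real Set.univ * δ ^ 2 := by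
  obtain ⟨hν, heq⟩ := toReal_HKfun_expansion hκ hfin hl hu
  have hself := toReal_HKfun_self hκ hfin
  have key : ∀ (f : Eucl n × Eucl n → Eucl n) (_ : Measurable f),
      (klDiv (ν.map f) (π.map f)).toReal ≤ π.real Set.univ * δ ^ 2 := by
    intro f hf
    have h : klDiv (ν.map f) (π.map f) ≤ ENNReal.ofReal ((δ : ℝ) ^ 2) * (π.map f) Set.univ := by
      refine klDiv_le_sq_mul ?_ ?_
      · rw [← Measure.map_smul]
        exact Measure.map_mono hl hf
      · rw [← Measure.map_smul]
        exact Measure.map_mono hu hf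
    refine (ENNReal.toReal_mono (by finiteness) h).trans_eq ?_
    rw [ENNReal.toReal_mul, ENNReal.toReal_ofReal (by positivity),
      Measure.map_apply hf MeasurableSet.univ, Set.preimage_univ, mul_comm, measureReal_def]
  have h0 := key Prod.fst measurable_fst
  have h1 := key Prod.snd measurable_snd
  have hle' := ENNReal.toReal_mono hν hle
  rw [heq, hself] at hle'
  nlinarith [mul_le_mul_of_nonneg_left (add_le_add h0 h1) (sq_nonneg κ)]

theorem nonneg_of_forall_small {a C : ℝ} (h : ∀ s : ℝ≥0, 0 < s → s ≤ 1 → 0 ≤ s * a + C * s ^ 2) :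
    0 ≤ a := by
  have hlim : Tendsto (fun s : ℝ => a + C * s) (𝓝[>] 0) (𝓝 (a + C * 0)) :=
    Tendsto.mono_left (Continuous.tendsto (by fun_prop) 0) nhdsWithin_le_nhds
  rw [mul_zero, add_zero] at hlim
  refine ge_of_tendsto hlim ?_
  filter_upwards [Ioc_mem_nhdsGT (zero_lt_one (α := ℝ))] with s hs
  have := h ⟨s, hs.1.le⟩ (by exact_mod_cast hs.1) (by exact_mod_cast hs.2)
  change 0 ≤ s * a + C * s ^ 2 at this
  exact nonneg_of_mul_nonneg_right (by linarith : 0 ≤ s * (a + C * s)) hs.1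

/-- First-order optimality: the first variation vanishes at a minimizer. -/
theorem hkVariation_ae_eq_zero (hκ : 0 < κ) {π : Measure (Eucl n × Eucl n)}
    [IsFiniteMeasure π] (hfin : HKfun κ π μ0 μ1 ≠ ⊤)
    (hmin : ∀ ν : Measure (Eucl n × Eucl n), IsFiniteMeasure ν →
      HKfun κ π μ0 μ1 ≤ HKfun κ ν μ0 μ1) :
    hkVariation κ π μ0 μ1 =ᵐ[π] 0 := by
  have hi := integrable_hkVariation hκ hfin
  have hnn : 0 ≤ᵐ[π] hkVariation κ π μ0 μ1 := by
    refine ae_nonneg_of_forall_setIntegral_nonneg hi fun A _ _ => ?_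
    refine nonneg_of_forall_small (C := 2 * κ ^ 2 * π.real Set.univ) fun s _ _ => ?_
    have := integral_hkVariation_le hκ (ν := π + s • π.restrict A) hfin (hmin _ inferInstance)
      (δ := s) ?_ ?_
    · rw [integral_add_measure hi (hi.restrict.smul_measure_nnreal),
        integral_smul_nnreal_measure, NNReal.smul_def, smul_eq_mul] at this
      linarith
    · refine le_trans ?_ (Measure.le_add_right le_rfl)
      intro t
      simpa using mul_le_of_le_one_left zero_le (by simp)
    · rw [add_smul, one_smul]
      gcongr
      exact Measure.restrict_le_self
  have hle : 0 ≤ -∫ p, hkVariation κ π μ0 μ1 p ∂π := by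
    refine nonneg_of_forall_small (C := 2 * κ ^ 2 * π.real Set.univ) fun s _ hs => ?_
    have := integral_hkVariation_le hκ (ν := (1 - s) • π) hfin (hmin _ inferInstance)
      (δ := s) le_rfl ?_
    · rw [integral_smul_nnreal_measure, NNReal.smul_def, smul_eq_mul, NNReal.coe_sub hs,
        NNReal.coe_one] at this
      linarith
    · gcongr
      exact tsub_le_self.trans le_self_add
  refine (integral_eq_zero_iff_of_nonneg_ae hnn hi).mp ?_
  exact le_antisymm (by linarith) (integral_nonneg_of_ae hnn)

end FirstOrderOptimality

section LogarithmicMap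

open InformationTheory
open scoped NNReal

theorem HK2_ne_top {n : ℕ} (κ : ℝ) (μ0 μ1 : Measure (Eucl n)) [IsFiniteMeasure μ0]
    [IsFiniteMeasure μ1] : HK2 κ μ0 μ1 ≠ ⊤ := by
  refine ne_top_of_le_ne_top ?_ 
    (iInf₂_le (f := fun π (_ : IsFiniteMeasure π) => HKfun κ π μ0 μ1) 0 inferInstance)
  simp only [HKfun, KLdiv_eq_klDiv, Measure.map_zero, klDiv_zero_left, lintegral_zero_measure]
  finiteness

/-- The total mass splits into the singular part and the integral of the density. -/
theorem singularPart_univ_add_lintegral_rnDeriv {α : Type*} [MeasurableSpace α]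
    (μ σ : Measure α) [IsFiniteMeasure μ] [IsFiniteMeasure σ] :
    μ.singularPart σ Set.univ + ∫⁻ x, μ.rnDeriv σ x ∂σ = μ Set.univ := by
  conv_rhs => rw [← Measure.singularPart_add_rnDeriv μ σ]
  simp

theorem HK2_add_two_mul_mass {n : ℕ} {κ : ℝ} (hκ : 0 < κ) {μ0 μ1 : Measure (Eucl n)}
    [IsFiniteMeasure μ0] [IsFiniteMeasure μ1] {π : Measure (Eucl n × Eucl n)} [IsFiniteMeasure π]
    (hopt : HKfun κ π μ0 μ1 = HK2 κ μ0 μ1) (hL : hkVariation κ π μ0 μ1 =ᵐ[π] 0) :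
    HK2 κ μ0 μ1 + ENNReal.ofReal (κ ^ 2) * 2 * π Set.univ
      = ENNReal.ofReal (κ ^ 2) * (μ0 Set.univ + μ1 Set.univ) := by
  have hself := toReal_HKfun_self hκ (hopt ▸ HK2_ne_top κ μ0 μ1)
  rw [hopt, integral_congr_ae hL] at hself
  have hne := HK2_ne_top κ μ0 μ1
  rw [← ENNReal.toReal_eq_toReal_iff' (by finiteness) (by finiteness),
    ENNReal.toReal_add (by finiteness) (by finiteness), hself]
  simp [ENNReal.toReal_add, measureReal_def, sq_nonneg]
  ring

theorem log_norm_pointwise {κ u0 u1 θ : ℝ} (hκ : 0 < κ) (hu0 : 0 < u0) (hu1 : 0 < u1)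
    (hθ : 0 < Real.cos θ)
    (h : -2 * κ ^ 2 * Real.log (Real.cos θ) + κ ^ 2 * Real.log u0 + κ ^ 2 * Real.log u1 = 0) :
    u0⁻¹ * ((κ * u0 * Real.tan θ) ^ 2 + κ ^ 2 / 4 * (2 * (u0 - 1)) ^ 2) + κ ^ 2 * 2
      = κ ^ 2 * (u0⁻¹ + u1⁻¹) := by
  have hprod : u0 * u1 = Real.cos θ ^ 2 := by
    refine Real.log_injOn_pos (mul_pos hu0 hu1) (pow_pos hθ 2) ?_
    rw [Real.log_mul hu0.ne' hu1.ne', Real.log_pow]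
    have hκ2 : κ ^ 2 ≠ 0 := by positivity
    refine mul_left_cancel₀ hκ2 ?_
    push_cast
    linarith
  have htan : Real.tan θ ^ 2 = (u0 * u1)⁻¹ - 1 := by
    rw [hprod, Real.tan_eq_sin_div_cos, div_pow, Real.sin_sq]
    field_simp
  rw [mul_pow, htan]
  field_simp
  ring

theorem norm_log_velocity {E : Type*} [NormedAddCommGroup E] [NormedSpace ℝ E] (a κ : ℝ) (d : E) :
    ‖(a * Real.tan (‖d‖ / κ) / ‖d‖) • d‖ ^ 2 = (a * Real.tan (‖d‖ / κ)) ^ 2 := by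
  rcases eq_or_ne d 0 with rfl | hd
  · simp
  · rw [norm_smul, mul_pow, Real.norm_eq_abs, sq_abs, ← mul_pow,
      div_mul_cancel₀ _ (norm_ne_zero_iff.mpr hd)]

/-- On pairs at distance less than `κπ/2`, the cosine is positive and the cost is explicit. -/
theorem cHK_toReal_of_ne_top {n : ℕ} {κ : ℝ} (hκ : 0 < κ) {x y : Eucl n} (h : cHK κ x y ≠ ⊤) :
    0 < Real.cos (dist x y / κ) ∧
      (cHK κ x y).toReal = -2 * κ ^ 2 * Real.log (Real.cos (dist x y / κ)) := by
  have hd : dist x y < κ * Real.pi / 2 := by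
    by_contra hd
    exact h (if_neg hd)
  have hθ : dist x y / κ < Real.pi / 2 := by
    rw [div_lt_iff₀ hκ]
    linarith
  have hθ0 : 0 ≤ dist x y / κ := by positivity
  have hcos := Real.cos_pos_of_mem_Ioo ⟨by linarith [Real.pi_pos], hθ⟩
  refine ⟨hcos, ?_⟩
  rw [cHK, if_pos hd, ENNReal.toReal_ofReal]
  have := Real.log_nonpos hcos.le (Real.cos_le_one _)
  nlinarith [sq_nonneg κ]

end LogarithmicMap

/-- `HK_κ²(μ0,μ1)` as the squared norm of the logarithmic map. -/
theorem hk_sq_eq_log_norm_sq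
    {n : ℕ} (hn : 1 ≤ n) (κ : ℝ) (hκ : 0 < κ)
    (μ0 μ1 : Measure (Eucl n)) [IsFiniteMeasure μ0] [IsFiniteMeasure μ1]
    (hμ0K : ∃ K : Set (Eucl n), IsCompact K ∧ μ0 Kᶜ = 0)
    (hμ1K : ∃ K : Set (Eucl n), IsCompact K ∧ μ1 Kᶜ = 0)
    (hμ0ac : μ0 ≪ (volume : Measure (Eucl n)))
    -- `π = (id,T)_# π0` is the unique minimizer of `E_κ(·|μ0,μ1)`
    (π : Measure (Eucl n × Eucl n)) [IsFiniteMeasure π]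
    (hπopt : HKfun κ π μ0 μ1 = HK2 κ μ0 μ1)
    (hπuniq : ∀ π' : Measure (Eucl n × Eucl n), IsFiniteMeasure π' →
      HKfun κ π' μ0 μ1 = HK2 κ μ0 μ1 → π' = π)
    (T : Eucl n → Eucl n) (hT : Measurable T)
    (hπT : π = (π.map Prod.fst).map (fun x => (x, T x)))
    -- the components `(v0, α0, μ1^⊥)` of the HK logarithmic map
    (v0 : Eucl n → Eucl n) (α0 : Eucl n → ℝ)
    (hv0 : ∀ᵐ x ∂(π.map Prod.fst), v0 x =
      (κ * ((π.map Prod.fst).rnDeriv μ0 x).toReal * Real.tan (‖T x - x‖ / κ) / ‖T x - x‖) •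
        (T x - x))
    (hv0perp : ∀ᵐ x ∂(μ0.singularPart (π.map Prod.fst)), v0 x = 0)
    (hα0 : ∀ᵐ x ∂(π.map Prod.fst),
      α0 x = 2 * (((π.map Prod.fst).rnDeriv μ0 x).toReal - 1))
    (hα0perp : ∀ᵐ x ∂(μ0.singularPart (π.map Prod.fst)), α0 x = -2) :
    HK2 κ μ0 μ1 = ∫⁻ x, ENNReal.ofReal (‖v0 x‖ ^ 2) ∂μ0
      + ENNReal.ofReal (κ ^ 2 / 4) * ∫⁻ x, ENNReal.ofReal (α0 x ^ 2) ∂μ0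
      + ENNReal.ofReal (κ ^ 2) * μ1.singularPart (π.map Prod.snd) Set.univ := by
  have hmin : ∀ ν : Measure (Eucl n × Eucl n), IsFiniteMeasure ν →
      HKfun κ π μ0 μ1 ≤ HKfun κ ν μ0 μ1 := fun ν hν => hπopt ▸ iInf₂_le ν hν
  have hfin : HKfun κ π μ0 μ1 ≠ ⊤ := hπopt ▸ HK2_ne_top κ μ0 μ1
  have hL := hkVariation_ae_eq_zero hκ hfin hmin
  have hLHS := HK2_add_two_mul_mass hκ hπopt hL
  obtain ⟨hc, hk0, hk1⟩ := (HKfun_ne_top_iff hκ π).mp hfin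
  have hac0 := (InformationTheory.klDiv_ne_top_iff.mp hk0).1
  have hac1 := (InformationTheory.klDiv_ne_top_iff.mp hk1).1
  have hcT : ∀ᵐ p ∂π, cHK κ p.1 p.2 < ⊤ := ae_lt_top (measurable_cHK κ) hc
  have hmass : (π.map Prod.fst) Set.univ = π Set.univ := by
    rw [Measure.map_apply measurable_fst MeasurableSet.univ, Set.preimage_univ]
  set σ := π.map Prod.fst with hσ
  set τ := π.map Prod.snd with hτ
  have : IsFiniteMeasure σ := Measure.isFiniteMeasure_map π Prod.fst
  have : IsFiniteMeasure τ := Measure.isFiniteMeasure_map π Prod.snd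
  have hg : Measurable fun x => (x, T x) := measurable_id.prodMk hT
  have hτT : τ = σ.map T := by
    rw [hτ, hπT, Measure.map_map measurable_snd hg]
    rfl
  have transfer : ∀ {P : Eucl n × Eucl n → Prop}, (∀ᵐ p ∂π, P p) → ∀ᵐ x ∂σ, P (x, T x) :=
    fun h => ae_of_ae_map hg.aemeasurable (by rwa [← hπT])
  have transferT : ∀ {P : Eucl n → Prop}, (∀ᵐ y ∂τ, P y) → ∀ᵐ x ∂σ, P (T x) :=
    fun h => ae_of_ae_map hT.aemeasurable (by rwa [← hτT])
  have hleb : μ0.HaveLebesgueDecomposition σ :=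
    Measure.haveLebesgueDecomposition_of_sigmaFinite μ0 σ
  have hdec := Measure.singularPart_add_rnDeriv μ0 σ
  have hwac : σ.withDensity (μ0.rnDeriv σ) ≪ σ := withDensity_absolutelyContinuous _ _
  have hα0m : AEMeasurable α0 μ0 := by
    rw [← hdec]
    refine AEMeasurable.add_measure ⟨fun _ => -2, measurable_const, hα0perp⟩
      ⟨_, ?_, hwac.ae_le hα0⟩
    exact ((Measure.measurable_rnDeriv _ _).ennreal_toReal.sub_const _).const_mul _
  have hα0m' : AEMeasurable (fun x => ENNReal.ofReal (α0 x ^ 2)) μ0 :=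
    (hα0m.pow_const 2).ennreal_ofReal
  rw [← lintegral_const_mul'' _ hα0m', ← lintegral_add_right' _ (hα0m'.const_mul _)]
  set F : Eucl n → ℝ≥0∞ := fun x =>
    ENNReal.ofReal (‖v0 x‖ ^ 2) + ENNReal.ofReal (κ ^ 2 / 4) * ENNReal.ofReal (α0 x ^ 2) with hF
  have hsing : ∫⁻ x, F x ∂(μ0.singularPart σ)
      = ENNReal.ofReal (κ ^ 2) * μ0.singularPart σ Set.univ := by
    rw [← lintegral_const]
    refine lintegral_congr_ae ?_
    filter_upwards [hv0perp, hα0perp] with x h1 h2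
    rw [hF]
    simp only [h1, h2]
    rw [← ENNReal.ofReal_mul (by positivity), ← ENNReal.ofReal_add (by positivity) (by positivity)]
    congr 1
    simp
    ring
  have hpt : ∀ᵐ x ∂σ, (μ0.rnDeriv σ * F) x + ENNReal.ofReal (κ ^ 2) * 2
      = ENNReal.ofReal (κ ^ 2) * (μ0.rnDeriv σ x + μ1.rnDeriv τ (T x)) := by
    filter_upwards [hv0, hα0, transfer hL, transfer hcT, Measure.rnDeriv_pos hac0,
      hac0.ae_le (Measure.rnDeriv_lt_top σ μ0), Measure.inv_rnDeriv hac0,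
      transferT (Measure.rnDeriv_pos hac1), transferT (hac1.ae_le (Measure.rnDeriv_lt_top τ μ1)),
      transferT (Measure.inv_rnDeriv hac1)] with x hv hα hLx hcx hp0 ht0 hi0 hp1 ht1 hi1
    obtain ⟨hcos, hcr⟩ := cHK_toReal_of_ne_top hκ hcx.ne
    rw [hkVariation, hcr] at hLx
    have hu0 := ENNReal.toReal_pos hp0.ne' ht0.ne
    have hu1 := ENNReal.toReal_pos hp1.ne' ht1.ne
    have key := log_norm_pointwise hκ hu0 hu1 hcos hLx
    have e0 : μ0.rnDeriv σ x = ENNReal.ofReal (σ.rnDeriv μ0 x).toReal⁻¹ := by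
      rw [ENNReal.ofReal_inv_of_pos hu0, ENNReal.ofReal_toReal ht0.ne, ← hi0, Pi.inv_apply]
    have e1 : μ1.rnDeriv τ (T x) = ENNReal.ofReal (τ.rnDeriv μ1 (T x)).toReal⁻¹ := by
      rw [ENNReal.ofReal_inv_of_pos hu1, ENNReal.ofReal_toReal ht1.ne, ← hi1, Pi.inv_apply]
    rw [dist_comm, dist_eq_norm] at key
    rw [Pi.mul_apply, hF, e0, e1]
    simp only [hv, hα, norm_log_velocity]
    rw [← ENNReal.ofReal_mul (by positivity), ← ENNReal.ofReal_add (by positivity) (by positivity),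
      ← ENNReal.ofReal_mul (by positivity), ← ENNReal.ofReal_add (by positivity) (by positivity),
      ← ENNReal.ofReal_mul (by positivity), ← key,
      ENNReal.ofReal_add (by positivity) (by positivity),
      ENNReal.ofReal_mul (q := 2) (by positivity), ENNReal.ofReal_ofNat]
  have hw1 : ∫⁻ x, μ1.rnDeriv τ (T x) ∂σ = ∫⁻ y, μ1.rnDeriv τ y ∂τ := by
    conv_rhs => rw [hτT]
    rw [lintegral_map (by rw [← hτT]; exact Measure.measurable_rnDeriv _ _) hT, ← hτT]
  have hreg : ∫⁻ x, F x ∂(σ.withDensity (μ0.rnDeriv σ)) + ENNReal.ofReal (κ ^ 2) * 2 * π Set.univ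
      = ENNReal.ofReal (κ ^ 2) * (∫⁻ x, μ0.rnDeriv σ x ∂σ + ∫⁻ y, μ1.rnDeriv τ y ∂τ) := by
    rw [lintegral_withDensity_eq_lintegral_mul_non_measurable _ (Measure.measurable_rnDeriv _ _)
        (Measure.rnDeriv_lt_top _ _), ← hmass, ← lintegral_const,
      ← lintegral_add_right _ measurable_const, lintegral_congr_ae hpt,
      lintegral_const_mul' _ _ (by finiteness),
      lintegral_add_left (Measure.measurable_rnDeriv _ _), hw1]
  have hsplit : ∫⁻ x, F x ∂μ0 = ∫⁻ x, F x ∂(μ0.singularPart σ)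
      + ∫⁻ x, F x ∂(σ.withDensity (μ0.rnDeriv σ)) := by
    rw [← lintegral_add_measure, hdec]
  refine (ENNReal.add_left_inj (a := ENNReal.ofReal (κ ^ 2) * 2 * π Set.univ)
    (by finiteness)).mp ?_
  rw [hLHS, hsplit, hsing, add_right_comm, add_assoc (_ * _) (lintegral _ _), hreg,
    ← singularPart_univ_add_lintegral_rnDeriv μ0 σ, ← singularPart_univ_add_lintegral_rnDeriv μ1 τ]
  ring
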